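/- For every k ≥ 2 and every n ≥ 1, the circular total chromatic number of G_{k,n} satisfies k + 1 < χ''_c(G_{k,n}) ≤ k + 1 + 1/n. Consequently, χ''_c(G_{k,n}) → k+1 as n → ∞, and k+1 is an accumulation point of the set of circular total chromatic numbers of graphs with maximum degree k. -/

import Mathlib

open SimpleGraph

/-- A proper total colouring of `G` with `p` colours: vertex colours `cv`,
edge colours `ce` (symmetric on adjacent pairs); adjacent vertices, adjacent
edges and incident vertex-edge pairs get distinct colours. -/
def IsTotalColoring {V : Type*} (G : SimpleGraph V) (p : ℕ)
    (cv : V → Fin p) (ce : V → V → Fin p) : Prop :=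
  (∀ u v, G.Adj u v → ce u v = ce v u) ∧
  (∀ u v, G.Adj u v → cv u ≠ cv v) ∧
  (∀ u v w, G.Adj u v → G.Adj u w → v ≠ w → ce u v ≠ ce u w) ∧
  (∀ u v, G.Adj u v → ce u v ≠ cv u ∧ ce u v ≠ cv v)

/-- circular distance condition: `q ≤ |a - b| ≤ p - q`. -/
def circOk (p q a b : ℕ) : Prop :=
  q ≤ max a b - min a b ∧ max a b - min a b ≤ p - q

/-- A `(p,q)`-total colouring of `G`. -/
def IsCircTotalColoring {V : Type*} (G : SimpleGraph V) (p q : ℕ)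
    (cv : V → ℕ) (ce : V → V → ℕ) : Prop :=
  (∀ v, cv v < p) ∧
  (∀ u v, G.Adj u v → ce u v < p) ∧
  (∀ u v, G.Adj u v → ce u v = ce v u) ∧
  (∀ u v, G.Adj u v → circOk p q (cv u) (cv v)) ∧
  (∀ u v w, G.Adj u v → G.Adj u w → v ≠ w → circOk p q (ce u v) (ce u w)) ∧
  (∀ u v, G.Adj u v → circOk p q (ce u v) (cv u) ∧ circOk p q (ce u v) (cv v))

/-- The circular total chromatic number of `G`. -/
noncomputable def circTotalChromatic {V : Type*} (G : SimpleGraph V) : ℝ :=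
  sInf {x : ℝ | ∃ p q : ℕ, 0 < q ∧
    (∃ cv ce, IsCircTotalColoring G p q cv ce) ∧ x = (p : ℝ) / q}

/-- The chain graph `G_{k,n}`: `n` blocks, each a copy of `K_{k,k-1}` with
partite sets `Fin k` (the `X`-side) and `Fin (k-1)` (the `Y`-side); in block `i`
the designated link vertices are `x_i = (i, inl 0)` and `x'_i = (i, inl 1)`;
the extra vertex `u` is `none`, joined to `x'_1` and `x_n`, and `x_i` is joined
to `x'_{i+1}`. -/
def Gkn (k n : ℕ) : SimpleGraph (Option (Fin n × (Fin k ⊕ Fin (k - 1)))) :=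
  SimpleGraph.fromRel (fun a b =>
    (∃ (i : Fin n) (x : Fin k) (y : Fin (k - 1)),
        a = some (i, Sum.inl x) ∧ b = some (i, Sum.inr y)) ∨
    (∃ (i j : Fin n) (x x' : Fin k), (j : ℕ) = (i : ℕ) + 1 ∧ (x : ℕ) = 0 ∧ (x' : ℕ) = 1 ∧
        a = some (i, Sum.inl x) ∧ b = some (j, Sum.inl x')) ∨
    (∃ (i : Fin n) (x' : Fin k), (i : ℕ) = 0 ∧ (x' : ℕ) = 1 ∧
        a = none ∧ b = some (i, Sum.inl x')) ∨
    (∃ (i : Fin n) (x : Fin k), (i : ℕ) = n - 1 ∧ (x : ℕ) = 0 ∧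
        a = some (i, Sum.inl x) ∧ b = none))


/-! ### Passing to the limit: a lower bound for the circular total chromatic number -/

/-- The real analogue of `circOk`, with `p / q` replaced by a real `r`. -/
def circOkReal (r a b : ℝ) : Prop := 1 ≤ |a - b| ∧ |a - b| ≤ r - 1

/-- A circular total colouring of `G` with colours in a circle of length `r`. -/
def IsRealTotalColoring {V : Type*} (G : SimpleGraph V) (r : ℝ)
    (f : V → ℝ) (g : V → V → ℝ) : Prop :=
  (∀ v, 0 ≤ f v ∧ f v ≤ r) ∧
  (∀ u v, 0 ≤ g u v ∧ g u v ≤ r) ∧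
  (∀ u v, G.Adj u v → g u v = g v u) ∧
  (∀ u v, G.Adj u v → circOkReal r (f u) (f v)) ∧
  (∀ u v w, G.Adj u v → G.Adj u w → v ≠ w → circOkReal r (g u v) (g u w)) ∧
  (∀ u v, G.Adj u v → circOkReal r (g u v) (f u) ∧ circOkReal r (g u v) (f v))

lemma circOk.real {p q a b : ℕ} (hq : 0 < q) (h : circOk p q a b) :
    circOkReal ((p : ℝ) / q) ((a : ℝ) / q) ((b : ℝ) / q) := by
  obtain ⟨h1, h2⟩ := h
  have hq' : (0 : ℝ) < q := by exact_mod_cast hq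
  have hd : (a : ℝ) / q - b / q = (a - b) / q := by ring
  have hr : (p : ℝ) / q - 1 = (p - q) / q := by field_simp
  rw [circOkReal, hd, hr, abs_div, abs_of_pos hq', le_div_iff₀ hq', one_mul,
    div_le_div_iff_of_pos_right hq']
  rcases le_total a b with hab | hab
  · rw [abs_sub_comm, abs_of_nonneg (sub_nonneg.2 (by exact_mod_cast hab))]
    have e1 : q + a ≤ b := by omega
    have e2 : b + q ≤ p + a := by omega
    have e1' : (q : ℝ) + a ≤ b := by exact_mod_cast e1
    have e2' : (b : ℝ) + q ≤ p + a := by exact_mod_cast e2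
    constructor <;> linarith
  · rw [abs_of_nonneg (sub_nonneg.2 (by exact_mod_cast hab))]
    have e1 : q + b ≤ a := by omega
    have e2 : a + q ≤ p + b := by omega
    have e1' : (q : ℝ) + b ≤ a := by exact_mod_cast e1
    have e2' : (a : ℝ) + q ≤ p + b := by exact_mod_cast e2
    constructor <;> linarith

lemma IsCircTotalColoring.exists_real {V : Type*} {G : SimpleGraph V} {p q : ℕ}
    {cv : V → ℕ} {ce : V → V → ℕ} (hq : 0 < q) (h : IsCircTotalColoring G p q cv ce) :
    ∃ f g, IsRealTotalColoring G ((p : ℝ) / q) f g := by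
  classical
  obtain ⟨h1, h2, h3, h4, h5, h6⟩ := h
  have hle : ∀ a : ℕ, a < p → 0 ≤ (a : ℝ) / q ∧ (a : ℝ) / q ≤ (p : ℝ) / q := by
    intro a ha
    have : (a : ℝ) ≤ p := by exact_mod_cast ha.le
    exact ⟨by positivity, by gcongr⟩
  refine ⟨fun v => (cv v : ℝ) / q, fun u v => if G.Adj u v then (ce u v : ℝ) / q else 0,
    fun v => hle _ (h1 v), fun u v => ?_, fun u v huv => ?_, fun u v huv => (h4 u v huv).real hq,
    fun u v w huv huw hvw => ?_, fun u v huv => ?_⟩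
  · dsimp only
    split_ifs with huv
    · exact hle _ (h2 u v huv)
    · exact ⟨le_rfl, by positivity⟩
  · simp only [huv, huv.symm, if_true, h3 u v huv]
  · simpa only [huv, huw, if_true] using (h5 u v w huv huw hvw).real hq
  · simpa only [huv, if_true] using ⟨(h6 u v huv).1.real hq, (h6 u v huv).2.real hq⟩

lemma isCompact_setOf_isRealTotalColoring {V : Type*} (G : SimpleGraph V) (M : ℝ) :
    IsCompact {t : ℝ × (V → ℝ) × (V → V → ℝ) |
      t.1 ≤ M ∧ 0 ≤ t.1 ∧ IsRealTotalColoring G t.1 t.2.1 t.2.2} := by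
  refine (isCompact_Icc (a := ((0, 0, 0) : ℝ × (V → ℝ) × (V → V → ℝ)))
    (b := (M, fun _ => M, fun _ _ => M))).of_isClosed_subset ?_ ?_
  · simp only [IsRealTotalColoring, circOkReal, Set.ofPred_and, Set.ofPred_forall]
    have hc : ∀ u v : V, Continuous fun t : ℝ × (V → ℝ) × (V → V → ℝ) => t.2.2 u v := by
      intro u v
      fun_prop
    repeat' first
      | apply IsClosed.inter
      | (apply isClosed_iInter; intro)
      | exact isClosed_le (by fun_prop) (by fun_prop)
      | exact isClosed_eq (by fun_prop) (by fun_prop)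
  · rintro ⟨r, f, g⟩ ⟨hM, h0, hf, hg, -⟩
    exact ⟨⟨h0, fun v => (hf v).1, fun u v => (hg u v).1⟩,
      ⟨hM, fun v => (hf v).2.trans hM, fun u v => (hg u v).2.trans hM⟩⟩

lemma floor_mod_ne {K : ℕ} {r a b : ℝ} (hr : r ≤ K) (ha : 0 ≤ a ∧ a ≤ r) (hb : 0 ≤ b ∧ b ≤ r)
    (h : circOkReal r a b) : ⌊a⌋₊ % K ≠ ⌊b⌋₊ % K := by
  wlog hab : a ≤ b generalizing a b
  · exact (this hb ha (by rwa [circOkReal, abs_sub_comm] at h) (le_of_not_ge hab)).symm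
  obtain ⟨h1, h2⟩ := h
  rw [abs_sub_comm, abs_of_nonneg (sub_nonneg.2 hab)] at h1 h2
  have hlt : ⌊a⌋₊ + 1 ≤ ⌊b⌋₊ := by
    rw [← Nat.floor_add_one ha.1]
    exact Nat.floor_le_floor (by linarith)
  have hbK : ⌊b⌋₊ + 1 ≤ ⌊a⌋₊ + K := by
    have : ⌊b + 1⌋₊ ≤ ⌊a + K⌋₊ := Nat.floor_le_floor (by linarith)
    rwa [Nat.floor_add_one hb.1, Nat.floor_add_natCast ha.1] at this
  intro he
  have hd : K ∣ ⌊b⌋₊ - ⌊a⌋₊ := (Nat.modEq_iff_dvd' (by omega)).1 he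
  have := Nat.le_of_dvd (by omega) hd
  omega

lemma IsRealTotalColoring.exists_isTotalColoring {V : Type*} {G : SimpleGraph V} {K : ℕ} {r : ℝ}
    {f : V → ℝ} {g : V → V → ℝ} (hK : 0 < K) (hr : r ≤ K) (h : IsRealTotalColoring G r f g) :
    ∃ cv ce, IsTotalColoring G K cv ce := by
  obtain ⟨h1, h2, h3, h4, h5, h6⟩ := h
  refine ⟨fun v => ⟨⌊f v⌋₊ % K, Nat.mod_lt _ hK⟩, fun u v => ⟨⌊g u v⌋₊ % K, Nat.mod_lt _ hK⟩,
    fun u v huv => by simp only [h3 u v huv], fun u v huv => ?_, fun u v w huv huw hvw => ?_,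
    fun u v huv => ⟨?_, ?_⟩⟩ <;> rw [Ne, Fin.mk.injEq]
  · exact floor_mod_ne hr (h1 u) (h1 v) (h4 u v huv)
  · exact floor_mod_ne hr (h2 u v) (h2 u w) (h5 u v w huv huw hvw)
  · exact floor_mod_ne hr (h2 u v) (h1 u) (h6 u v huv).1
  · exact floor_mod_ne hr (h2 u v) (h1 v) (h6 u v huv).2

/-- A graph with some circular total colouring but no total colouring with `K` colours has
circular total chromatic number strictly greater than `K`. -/
theorem lt_circTotalChromatic {V : Type*} {G : SimpleGraph V} {K : ℕ} (hK : 0 < K)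
    (hno : ¬ ∃ cv ce, IsTotalColoring G K cv ce)
    (hne : ∃ p q, 0 < q ∧ ∃ cv ce, IsCircTotalColoring G p q cv ce) :
    (K : ℝ) < circTotalChromatic G := by
  have hT := (isCompact_setOf_isRealTotalColoring G (K + 1)).image continuous_fst
  set T := Prod.fst '' {t : ℝ × (V → ℝ) × (V → V → ℝ) |
      t.1 ≤ K + 1 ∧ 0 ≤ t.1 ∧ IsRealTotalColoring G t.1 t.2.1 t.2.2}
  obtain ⟨m, hKm, hm⟩ : ∃ m : ℝ, (K : ℝ) < m ∧ ∀ x ∈ T, m ≤ x := by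
    rcases T.eq_empty_or_nonempty with hE | hN
    · exact ⟨K + 1, by linarith, by simp [hE]⟩
    · obtain ⟨m, hmT, hm⟩ := hT.exists_isLeast hN
      refine ⟨m, ?_, fun x hx => hm hx⟩
      obtain ⟨⟨r, f, g⟩, ⟨-, -, hfg⟩, rfl⟩ := hmT
      by_contra! hle
      exact hno (hfg.exists_isTotalColoring hK hle)
  refine lt_of_lt_of_le (lt_min hKm (lt_add_one (K : ℝ))) (le_csInf ?_ ?_)
  · obtain ⟨p, q, hq, hc⟩ := hne
    exact ⟨_, p, q, hq, hc, rfl⟩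
  · rintro x ⟨p, q, hq, ⟨cv, ce, hc⟩, rfl⟩
    rcases le_total ((p : ℝ) / q) (K + 1) with hle | hle
    · obtain ⟨f, g, hfg⟩ := hc.exists_real hq
      exact (min_le_left _ _).trans (hm _ ⟨(_, f, g), ⟨hle, by positivity, hfg⟩, rfl⟩)
    · exact (min_le_right _ _).trans hle

lemma circTotalChromatic_le {V : Type*} {G : SimpleGraph V} {p q : ℕ} {cv : V → ℕ}
    {ce : V → V → ℕ} (hq : 0 < q) (h : IsCircTotalColoring G p q cv ce) :
    circTotalChromatic G ≤ (p : ℝ) / q := by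
  refine csInf_le ⟨0, ?_⟩ ⟨p, q, hq, ⟨cv, ce, h⟩, rfl⟩
  rintro x ⟨p, q, -, -, rfl⟩
  positivity

/-! ### Invariance under isomorphism -/

lemma IsCircTotalColoring.comp_iso {V W : Type*} {G : SimpleGraph V} {H : SimpleGraph W}
    (φ : G ≃g H) {p q : ℕ} {cv : W → ℕ} {ce : W → W → ℕ} (h : IsCircTotalColoring H p q cv ce) :
    IsCircTotalColoring G p q (fun v => cv (φ v)) (fun u v => ce (φ u) (φ v)) := by
  obtain ⟨h1, h2, h3, h4, h5, h6⟩ := h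
  exact ⟨fun v => h1 _, fun u v e => h2 _ _ (φ.map_adj_iff.2 e),
    fun u v e => h3 _ _ (φ.map_adj_iff.2 e), fun u v e => h4 _ _ (φ.map_adj_iff.2 e),
    fun u v w e e' hne => h5 _ _ _ (φ.map_adj_iff.2 e) (φ.map_adj_iff.2 e') (φ.injective.ne hne),
    fun u v e => h6 _ _ (φ.map_adj_iff.2 e)⟩

lemma circTotalChromatic_congr {V W : Type*} {G : SimpleGraph V} {H : SimpleGraph W}
    (φ : G ≃g H) : circTotalChromatic G = circTotalChromatic H := by
  unfold circTotalChromatic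
  congr 1
  ext x
  constructor
  · rintro ⟨p, q, hq, ⟨cv, ce, h⟩, rfl⟩
    exact ⟨p, q, hq, ⟨_, _, h.comp_iso φ.symm⟩, rfl⟩
  · rintro ⟨p, q, hq, ⟨cv, ce, h⟩, rfl⟩
    exact ⟨p, q, hq, ⟨_, _, h.comp_iso φ⟩, rfl⟩

/-! ### Adjacency in `Gkn` -/

section Adjacency

variable {k n : ℕ}

lemma Gkn_adj_inl_inr (i : Fin n) (x : Fin k) (y : Fin (k - 1)) :
    (Gkn k n).Adj (some (i, Sum.inl x)) (some (i, Sum.inr y)) := by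
  rw [Gkn, SimpleGraph.fromRel_adj]
  exact ⟨by simp, Or.inl (Or.inl ⟨i, x, y, rfl, rfl⟩)⟩

lemma Gkn_adj_link {i j : Fin n} {x x' : Fin k} (hij : (j : ℕ) = i + 1) (hx : (x : ℕ) = 0)
    (hx' : (x' : ℕ) = 1) : (Gkn k n).Adj (some (i, Sum.inl x)) (some (j, Sum.inl x')) := by
  rw [Gkn, SimpleGraph.fromRel_adj]
  refine ⟨?_, Or.inl (Or.inr (Or.inl ⟨i, j, x, x', hij, hx, hx', rfl, rfl⟩))⟩
  rintro h
  simp only [Option.some.injEq, Prod.mk.injEq, Sum.inl.injEq] at h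
  rw [h.2] at hx
  omega

lemma Gkn_adj_first {i : Fin n} {x' : Fin k} (hi : (i : ℕ) = 0) (hx' : (x' : ℕ) = 1) :
    (Gkn k n).Adj none (some (i, Sum.inl x')) := by
  rw [Gkn, SimpleGraph.fromRel_adj]
  exact ⟨by simp, Or.inl (Or.inr (Or.inr (Or.inl ⟨i, x', hi, hx', rfl, rfl⟩)))⟩

lemma Gkn_adj_last {i : Fin n} {x : Fin k} (hi : (i : ℕ) = n - 1) (hx : (x : ℕ) = 0) :
    (Gkn k n).Adj (some (i, Sum.inl x)) none := by
  rw [Gkn, SimpleGraph.fromRel_adj]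
  exact ⟨by simp, Or.inl (Or.inr (Or.inr (Or.inr ⟨i, x, hi, hx, rfl, rfl⟩)))⟩

lemma Gkn_adj_none {w} (h : (Gkn k n).Adj none w) :
    (∃ (i : Fin n) (x : Fin k), (i : ℕ) = 0 ∧ (x : ℕ) = 1 ∧ w = some (i, Sum.inl x)) ∨
    ∃ (i : Fin n) (x : Fin k), (i : ℕ) = n - 1 ∧ (x : ℕ) = 0 ∧ w = some (i, Sum.inl x) := by
  rw [Gkn, SimpleGraph.fromRel_adj] at h
  grind

lemma Gkn_adj_inr {i : Fin n} {y : Fin (k - 1)} {w}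
    (h : (Gkn k n).Adj (some (i, Sum.inr y)) w) : ∃ x : Fin k, w = some (i, Sum.inl x) := by
  rw [Gkn, SimpleGraph.fromRel_adj] at h
  grind

lemma Gkn_adj_inl {i : Fin n} {x : Fin k} {w} (h : (Gkn k n).Adj (some (i, Sum.inl x)) w) :
    (∃ y : Fin (k - 1), w = some (i, Sum.inr y)) ∨
    (∃ (j : Fin n) (x' : Fin k), (j : ℕ) = i + 1 ∧ (x : ℕ) = 0 ∧ (x' : ℕ) = 1 ∧
      w = some (j, Sum.inl x')) ∨
    (∃ (j : Fin n) (x' : Fin k), (i : ℕ) = j + 1 ∧ (x : ℕ) = 1 ∧ (x' : ℕ) = 0 ∧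
      w = some (j, Sum.inl x')) ∨
    ((i : ℕ) = 0 ∧ (x : ℕ) = 1 ∧ w = none) ∨ ((i : ℕ) = n - 1 ∧ (x : ℕ) = 0 ∧ w = none) := by
  rw [Gkn, SimpleGraph.fromRel_adj] at h
  rcases h with ⟨-, (h | h | h | h) | (h | h | h | h)⟩ <;> grind

lemma Gkn_adj_inl_unique {i : Fin n} {x : Fin k} {v w}
    (hv : (Gkn k n).Adj (some (i, Sum.inl x)) v) (hw : (Gkn k n).Adj (some (i, Sum.inl x)) w)
    (hv' : ¬ ∃ y, v = some (i, Sum.inr y)) (hw' : ¬ ∃ y, w = some (i, Sum.inr y)) : v = w := by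
  rcases (Gkn_adj_inl hv).resolve_left hv' with
    ⟨j, z, h1, h2, h3, rfl⟩ | ⟨j, z, h1, h2, h3, rfl⟩ | ⟨h1, h2, rfl⟩ | ⟨h1, h2, rfl⟩ <;>
  rcases (Gkn_adj_inl hw).resolve_left hw' with
    ⟨j', z', h4, h5, h6, rfl⟩ | ⟨j', z', h4, h5, h6, rfl⟩ | ⟨h4, h5, rfl⟩ | ⟨h4, h5, rfl⟩ <;>
  first
    | rfl
    | omega
    | (simp only [Option.some.injEq, Prod.mk.injEq, Sum.inl.injEq, Fin.ext_iff]; omega)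

end Adjacency

/-! ### `Gkn` has no total colouring with `k + 1` colours -/

/-- In a total colouring of `K_{k,k-1}` with `k + 1` colours some colour `β` is the only one
that can be given to further edges at the vertices of the part of size `k`. -/
lemma exists_forced_color {C : Type*} [Fintype C] [DecidableEq C] {k : ℕ} (hk : 2 ≤ k)
    (hC : Fintype.card C = k + 1) {vx : Fin k → C} {vy : Fin (k - 1) → C}
    {e : Fin k → Fin (k - 1) → C} (hv : ∀ x y, vx x ≠ vy y) (hex : ∀ x y, e x y ≠ vx x)
    (hey : ∀ x y, e x y ≠ vy y) (hx : ∀ x, Function.Injective (e x))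
    (hy : ∀ y, Function.Injective fun x => e x y) :
    ∃ β : C, ∀ x c, c ≠ vx x → (∀ y, c ≠ e x y) → c = β := by
  have hsurj : ∀ y c, c ≠ vy y → ∃ x, e x y = c := by
    intro y c hc
    have hinj : Function.Injective fun o : Option (Fin k) => o.elim (vy y) fun x => e x y := by
      rintro (_ | x) (_ | x') h
      · rfl
      · exact absurd h.symm (hey x' y)
      · exact absurd h (hey x y)
      · exact congrArg some (hy y h)
    obtain ⟨o, ho⟩ :=
      ((Fintype.bijective_iff_injective_and_card _).2 ⟨hinj, by simp [hC]⟩).2 c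
    rcases o with _ | x
    · exact absurd ho.symm hc
    · exact ⟨x, ho⟩
  have hvx : Function.Injective vx := by
    intro x x' hxx'
    by_contra hne
    choose s hs using fun y => hsurj y (vx x) (hv x y)
    have hsinj : Function.Injective s := by
      intro y y' h
      refine hx (s y) ?_
      rw [hs, h, hs]
    have hsub : Finset.univ.image s ⊆ ({x, x'} : Finset (Fin k))ᶜ := by
      intro z hz
      obtain ⟨y, -, rfl⟩ := Finset.mem_image.1 hz
      rw [Finset.mem_compl, Finset.mem_insert, Finset.mem_singleton]
      rintro (h | h)
      · exact hex (s y) y (by rw [hs, h])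
      · exact hex (s y) y (by rw [hs, h, hxx'])
    have hcard := Finset.card_le_card hsub
    rw [Finset.card_image_of_injective _ hsinj, Finset.card_compl, Finset.card_pair hne] at hcard
    simp only [Finset.card_univ, Fintype.card_fin] at hcard
    omega
  let y₀ : Fin (k - 1) := ⟨0, by omega⟩
  have hvy : ∀ y, vy y = vy y₀ := by
    intro y
    by_contra hne
    have hsub : Finset.univ.image vx ⊆ ({vy y, vy y₀} : Finset C)ᶜ := by
      intro z hz
      obtain ⟨x, -, rfl⟩ := Finset.mem_image.1 hz
      simp [hv]
    have hcard := Finset.card_le_card hsub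
    rw [Finset.card_image_of_injective _ hvx, Finset.card_compl, Finset.card_pair hne, hC] at hcard
    simp only [Finset.card_univ, Fintype.card_fin] at hcard
    omega
  refine ⟨vy y₀, fun x c hc hce => ?_⟩
  by_contra hne
  have hsub : Finset.univ.image (e x) ⊆ ({c, vx x, vy y₀} : Finset C)ᶜ := by
    intro z hz
    obtain ⟨y, -, rfl⟩ := Finset.mem_image.1 hz
    simp only [Finset.mem_compl, Finset.mem_insert, Finset.mem_singleton, not_or]
    exact ⟨(hce y).symm, hex x y, by rw [← hvy y]; exact hey x y⟩
  have hcard := Finset.card_le_card hsub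
  rw [Finset.card_image_of_injective _ (hx x), Finset.card_compl,
    Finset.card_eq_three.2 ⟨_, _, _, hc, hne, hv x y₀, rfl⟩, hC] at hcard
  simp only [Finset.card_univ, Fintype.card_fin] at hcard
  omega

theorem not_exists_isTotalColoring_Gkn {k n : ℕ} (hk : 2 ≤ k) (hn : 1 ≤ n) :
    ¬ ∃ cv ce, IsTotalColoring (Gkn k n) (k + 1) cv ce := by
  rintro ⟨cv, ce, hsymm, hvv, hee, hev⟩
  have hblock : ∀ i : Fin n, ∃ β : Fin (k + 1), ∀ (x : Fin k) (w),
      (Gkn k n).Adj (some (i, Sum.inl x)) w → (∀ y, w ≠ some (i, Sum.inr y)) →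
        ce (some (i, Sum.inl x)) w = β := by
    intro i
    have hadj := fun x y => Gkn_adj_inl_inr (k := k) i x y
    obtain ⟨β, hβ⟩ := exists_forced_color hk (Fintype.card_fin (k + 1))
      (vx := fun x => cv (some (i, Sum.inl x))) (vy := fun y => cv (some (i, Sum.inr y)))
      (e := fun x y => ce (some (i, Sum.inl x)) (some (i, Sum.inr y)))
      (fun x y => hvv _ _ (hadj x y)) (fun x y => (hev _ _ (hadj x y)).1)
      (fun x y => (hev _ _ (hadj x y)).2)
      (fun x y y' h => by
        by_contra hne
        exact hee _ _ _ (hadj x y) (hadj x y') (by simpa using hne) h)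
      (fun y x x' h => by
        by_contra hne
        refine hee _ _ _ (hadj x y).symm (hadj x' y).symm (by simpa using hne) ?_
        rw [← hsymm _ _ (hadj x y), ← hsymm _ _ (hadj x' y)]
        exact h)
    exact ⟨β, fun x w hw hne => hβ x _ (hev _ _ hw).1
      fun y => hee _ _ _ hw (hadj x y) (hne y)⟩
  choose β hβ using hblock
  let x₀ : Fin k := ⟨0, by omega⟩
  let x₁ : Fin k := ⟨1, by omega⟩
  have hconst : ∀ (i : ℕ) (hi : i < n), β ⟨i, hi⟩ = β ⟨0, by omega⟩ := by
    intro i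
    induction i with
    | zero => exact fun _ => rfl
    | succ i ih =>
      intro hi
      have hadj := Gkn_adj_link (i := ⟨i, by omega⟩) (j := ⟨i + 1, hi⟩) (x := x₀) (x' := x₁)
        rfl rfl rfl
      rw [← ih (by omega), ← hβ ⟨i, by omega⟩ x₀ _ hadj (by simp), hsymm _ _ hadj,
        hβ ⟨i + 1, hi⟩ x₁ _ hadj.symm (by simp)]
  have hf := Gkn_adj_first (i := (⟨0, by omega⟩ : Fin n)) (x' := x₁) rfl rfl
  have hl := Gkn_adj_last (i := (⟨n - 1, by omega⟩ : Fin n)) (x := x₀) rfl rfl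
  refine hee _ _ _ hf hl.symm (by simp [x₀, x₁]) ?_
  rw [hsymm _ _ hf, ← hsymm _ _ hl, hβ _ _ _ hf.symm (by simp), hβ _ _ _ hl (by simp),
    hconst (n - 1) (by omega)]

/-! ### A circular total colouring of `Gkn` -/

/-- The residue of `z` modulo `p` lies in `[q, p - q]`. -/
def FarMod (p q : ℕ) (z : ℤ) : Prop := ∃ m : ℤ, q ≤ z - m * p ∧ z - m * p ≤ p - q

lemma FarMod.neg {p q : ℕ} {z : ℤ} (h : FarMod p q z) : FarMod p q (-z) := by
  obtain ⟨m, h1, h2⟩ := h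
  exact ⟨-m - 1, by linarith, by linarith⟩

lemma FarMod.sub_comm {p q : ℕ} {y z : ℤ} (h : FarMod p q (y - z)) : FarMod p q (z - y) := by
  simpa using h.neg

lemma FarMod.circOk {p q : ℕ} {a b : ℤ} (hq : 0 < q) (h : FarMod p q (a - b)) :
    circOk p q (a % p).toNat (b % p).toNat := by
  obtain ⟨m, h1, h2⟩ := h
  have hp : (0 : ℤ) < p := by omega
  have ha := Int.emod_nonneg a hp.ne'
  have ha' := Int.emod_lt_of_pos a hp
  have hb := Int.emod_nonneg b hp.ne'
  have hb' := Int.emod_lt_of_pos b hp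
  have hda := Int.emod_add_mul_ediv a p
  have hdb := Int.emod_add_mul_ediv b p
  obtain ⟨t, ht⟩ : ∃ t : ℤ, t = a / p - b / p - m := ⟨_, rfl⟩
  have hz : a - b - m * p = a % p - b % p + t * p := by
    rw [ht]
    linarith
  have ht0 : 0 ≤ t := by
    by_contra! hneg
    nlinarith
  have ht1 : t ≤ 1 := by
    by_contra! hneg
    nlinarith
  rw [hz] at h1 h2
  unfold _root_.circOk
  obtain rfl | rfl : t = 0 ∨ t = 1 := by omega
  · simp only [zero_mul, add_zero] at h1 h2
    omega
  · simp only [one_mul] at h1 h2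
    omega

lemma isCircTotalColoring_emod {V : Type*} {G : SimpleGraph V} {p q : ℕ} (hp : 0 < p)
    (hq : 0 < q) {cv : V → ℤ} {ce : V → V → ℤ} (hsymm : ∀ u v, G.Adj u v → ce u v = ce v u)
    (hvv : ∀ u v, G.Adj u v → FarMod p q (cv u - cv v))
    (hee : ∀ u v w, G.Adj u v → G.Adj u w → v ≠ w → FarMod p q (ce u v - ce u w))
    (hev : ∀ u v, G.Adj u v → FarMod p q (ce u v - cv u)) :
    IsCircTotalColoring G p q (fun v => (cv v % p).toNat) (fun u v => (ce u v % p).toNat) := by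
  have hlt : ∀ z : ℤ, (z % p).toNat < p := by
    intro z
    have := Int.emod_lt_of_pos z (b := p) (by omega)
    omega
  refine ⟨fun v => hlt _, fun u v _ => hlt _, fun u v h => by simp only [hsymm u v h],
    fun u v h => (hvv u v h).circOk hq, fun u v w h h' hne => (hee u v w h h' hne).circOk hq,
    fun u v h => ⟨(hev u v h).circOk hq, ?_⟩⟩
  simp only [hsymm u v h]
  exact (hev v u h.symm).circOk hq

/-- Vertex colours of `Gkn` shifted by `-d` from each block to the next. -/
def chainVertexColor {k n : ℕ} (a : Fin k → ℤ) (b : Fin (k - 1) → ℤ) (d c : ℤ) :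
    Option (Fin n × (Fin k ⊕ Fin (k - 1))) → ℤ
  | none => c
  | some (i, Sum.inl x) => a x - d * (i : ℕ)
  | some (i, Sum.inr y) => b y - d * (i : ℕ)

/-- Edge colours of `Gkn` shifted by `-d` from each block to the next: `e` colours the first
block, and `l` is the colour of the edge entering it. -/
def chainEdgeColor {k n : ℕ} (e : Fin k → Fin (k - 1) → ℤ) (d l : ℤ) :
    Option (Fin n × (Fin k ⊕ Fin (k - 1))) → Option (Fin n × (Fin k ⊕ Fin (k - 1))) → ℤ
  | some (i, Sum.inl x), some (_, Sum.inr y) => e x y - d * (i : ℕ)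
  | some (i, Sum.inr y), some (_, Sum.inl x) => e x y - d * (i : ℕ)
  | some (i, Sum.inl x), _ => l - d * ((i : ℕ) + 1 - (x : ℕ))
  | none, some (i, Sum.inl x) => l - d * ((i : ℕ) + 1 - (x : ℕ))
  | _, _ => 0

lemma exists_isCircTotalColoring_Gkn_of_block {k n p q : ℕ} (hn : 1 ≤ n) (hp : 0 < p)
    (hq : 0 < q) (a : Fin k → ℤ) (b : Fin (k - 1) → ℤ) (e : Fin k → Fin (k - 1) → ℤ) (d l c : ℤ)
    (hab : ∀ x y, FarMod p q (a x - b y))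
    (hex : ∀ x y y', y ≠ y' → FarMod p q (e x y - e x y'))
    (hey : ∀ y x x', x ≠ x' → FarMod p q (e x y - e x' y))
    (hea : ∀ x y, FarMod p q (e x y - a x))
    (heb : ∀ x y, FarMod p q (e x y - b y))
    (hle : ∀ (x : Fin k) (y : Fin (k - 1)), (x : ℕ) ≤ 1 → FarMod p q (l - d * (1 - (x : ℕ)) - e x y))
    (hla : ∀ (x : Fin k), (x : ℕ) ≤ 1 → FarMod p q (l - d * (1 - (x : ℕ)) - a x))
    (hlink : ∀ x x' : Fin k, (x : ℕ) = 0 → (x' : ℕ) = 1 → FarMod p q (a x - a x' + d))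
    (hcfirst : ∀ (x : Fin k), (x : ℕ) = 1 → FarMod p q (c - a x))
    (hclast : ∀ (x : Fin k), (x : ℕ) = 0 → FarMod p q (c - a x + d * (n - 1)))
    (hlc : FarMod p q (l - c)) (hlc' : FarMod p q (l - d * n - c)) (hd : FarMod p q (d * n)) :
    ∃ cv ce, IsCircTotalColoring (Gkn k n) p q cv ce := by
  refine ⟨_, _, isCircTotalColoring_emod hp hq (cv := chainVertexColor a b d c)
    (ce := chainEdgeColor e d l) ?_ ?_ ?_ ?_⟩
  · rintro (_ | ⟨i, x | y⟩) w h
    · obtain ⟨j, x', -, -, rfl⟩ | ⟨j, x', -, -, rfl⟩ := Gkn_adj_none h <;> rfl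
    · obtain ⟨y, rfl⟩ | ⟨j, x', h1, h2, h3, rfl⟩ | ⟨j, x', h1, h2, h3, rfl⟩ | ⟨-, -, rfl⟩ |
        ⟨-, -, rfl⟩ := Gkn_adj_inl h
      · rfl
      · simp [chainEdgeColor, h1, h2, h3]
      · simp [chainEdgeColor, h1, h2, h3]
      · rfl
      · rfl
    · obtain ⟨x, rfl⟩ := Gkn_adj_inr h
      rfl
  · rintro (_ | ⟨i, x | y⟩) w h
    · obtain ⟨j, x', h1, h2, rfl⟩ | ⟨j, x', h1, h2, rfl⟩ := Gkn_adj_none h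
      · simpa [chainVertexColor, h1] using hcfirst x' h2
      · convert hclast x' h2 using 1
        simp only [chainVertexColor, h1]
        push_cast [hn]
        ring
    · obtain ⟨y, rfl⟩ | ⟨j, x', h1, h2, h3, rfl⟩ | ⟨j, x', h1, h2, h3, rfl⟩ | ⟨h1, h2, rfl⟩ |
        ⟨h1, h2, rfl⟩ := Gkn_adj_inl h
      · simpa [chainVertexColor] using hab x y
      · convert hlink x x' h2 h3 using 1
        simp only [chainVertexColor, h1]
        push_cast
        ring
      · convert (hlink x' x h3 h2).neg using 1
        simp only [chainVertexColor, h1]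
        push_cast
        ring
      · simpa [chainVertexColor, h1] using (hcfirst x h2).sub_comm
      · convert (hclast x h2).neg using 1
        simp only [chainVertexColor, h1]
        push_cast [hn]
        ring
    · obtain ⟨x, rfl⟩ := Gkn_adj_inr h
      simpa [chainVertexColor] using (hab x y).sub_comm
  · have key : ∀ (i : Fin n) (x : Fin k) (y : Fin (k - 1)) (w), (x : ℕ) ≤ 1 →
        (∀ y, w ≠ some (i, Sum.inr y)) → (Gkn k n).Adj (some (i, Sum.inl x)) w →
        FarMod p q (chainEdgeColor e d l (some (i, Sum.inl x)) w -
          chainEdgeColor (n := n) e d l (some (i, Sum.inl x)) (some (i, Sum.inr y))) := by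
      intro i x y w hx hw h
      have hw' : chainEdgeColor e d l (some (i, Sum.inl x)) w =
          l - d * ((i : ℕ) + 1 - (x : ℕ)) := by
        obtain ⟨y, rfl⟩ | ⟨j, x', -, -, -, rfl⟩ | ⟨j, x', -, -, -, rfl⟩ | ⟨-, -, rfl⟩ |
          ⟨-, -, rfl⟩ := Gkn_adj_inl h
        · exact absurd rfl (hw y)
        all_goals rfl
      rw [hw']
      convert hle x y hx using 1
      simp only [chainEdgeColor]
      ring
    rintro (_ | ⟨i, x | y⟩) v w hv hw hne
    · have hdn : ∀ (i j : Fin n) (x x' : Fin k), (i : ℕ) = 0 → (x : ℕ) = 1 →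
          (j : ℕ) = n - 1 → (x' : ℕ) = 0 →
          FarMod p q (chainEdgeColor e d l none (some (i, Sum.inl x)) -
            chainEdgeColor (n := n) e d l none (some (j, Sum.inl x'))) := by
        intro i j x x' h1 h2 h3 h4
        convert hd using 1
        simp only [chainEdgeColor, h1, h2, h3, h4]
        push_cast [hn]
        ring
      obtain ⟨i, x, h1, h2, rfl⟩ | ⟨i, x, h1, h2, rfl⟩ := Gkn_adj_none hv <;>
        obtain ⟨j, x', h3, h4, rfl⟩ | ⟨j, x', h3, h4, rfl⟩ := Gkn_adj_none hw
      · exact absurd (by simp [Fin.ext_iff, h1, h2, h3, h4]) hne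
      · exact hdn i j x x' h1 h2 h3 h4
      · exact (hdn j i x' x h3 h4 h1 h2).sub_comm
      · exact absurd (by simp [Fin.ext_iff, h1, h2, h3, h4]) hne
    · by_cases hvy : ∃ y, v = some (i, Sum.inr y) <;> by_cases hwy : ∃ y, w = some (i, Sum.inr y)
      · obtain ⟨y, rfl⟩ := hvy
        obtain ⟨y', rfl⟩ := hwy
        simpa [chainEdgeColor] using hex x y y' (by simpa using hne)
      · obtain ⟨y, rfl⟩ := hvy
        refine (key i x y w ?_ (by simpa using hwy) hw).sub_comm
        have := Gkn_adj_inl hw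
        grind
      · obtain ⟨y, rfl⟩ := hwy
        refine key i x y v ?_ (by simpa using hvy) hv
        have := Gkn_adj_inl hv
        grind
      · exact absurd (Gkn_adj_inl_unique hv hw hvy hwy) hne
    · obtain ⟨x, rfl⟩ := Gkn_adj_inr hv
      obtain ⟨x', rfl⟩ := Gkn_adj_inr hw
      simpa [chainEdgeColor] using hey y x x' (by simpa using hne)
  · rintro (_ | ⟨i, x | y⟩) w h
    · obtain ⟨j, x', h1, h2, rfl⟩ | ⟨j, x', h1, h2, rfl⟩ := Gkn_adj_none h
      · simpa [chainVertexColor, chainEdgeColor, h1, h2] using hlc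
      · convert hlc' using 1
        simp only [chainVertexColor, chainEdgeColor, h1, h2]
        push_cast [hn]
        ring
    · have key : (x : ℕ) ≤ 1 → FarMod p q (l - d * ((i : ℕ) + 1 - (x : ℕ)) -
          chainVertexColor (n := n) a b d c (some (i, Sum.inl x))) := by
        intro hx
        convert hla x hx using 1
        simp only [chainVertexColor]
        ring
      obtain ⟨y, rfl⟩ | ⟨j, x', h1, h2, h3, rfl⟩ | ⟨j, x', h1, h2, h3, rfl⟩ | ⟨h1, h2, rfl⟩ |
        ⟨h1, h2, rfl⟩ := Gkn_adj_inl h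
      · simpa [chainVertexColor, chainEdgeColor] using hea x y
      all_goals exact key (by omega)
    · obtain ⟨x, rfl⟩ := Gkn_adj_inr h
      simpa [chainVertexColor, chainEdgeColor] using heb x y

lemma exists_isCircTotalColoring_Gkn_two {n : ℕ} (hn : 1 ≤ n) :
    ∃ cv ce, IsCircTotalColoring (Gkn 2 n) (3 * n + 1) n cv ce := by
  refine exists_isCircTotalColoring_Gkn_of_block hn (by omega) hn
    (fun x => if (x : ℕ) = 0 then 3 * n - 1 else 2 * n) (fun _ => n - 1)
    (fun x _ => if (x : ℕ) = 0 then 2 * n - 1 else 3 * n) 2 n 0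
    ?_ ?_ ?_ ?_ ?_ ?_ ?_ ?_ ?_ ?_ ?_ ?_ ?_
  all_goals
    intros
    try split_ifs
    all_goals first
      | omega
      | exact ⟨0, by omega, by omega⟩
      | exact ⟨-1, by omega, by omega⟩

lemma farMod_symbol {k n : ℕ} {s t : ℕ} (hs : s < k) (ht : t < k) (hst : s ≠ t) :
    FarMod ((k + 1) * n + 1) n (((s : ℤ) + 1) * n - (t + 1) * n) := by
  rcases lt_or_gt_of_ne hst with h | h
  · exact ⟨-1, by push_cast; nlinarith, by push_cast; nlinarith⟩
  · exact ⟨0, by push_cast; nlinarith, by push_cast; nlinarith⟩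

lemma farMod_neg_symbol {k n s : ℕ} (hs : s < k) {δ : ℤ} (h0 : 0 ≤ δ) (h1 : δ ≤ 1) :
    FarMod ((k + 1) * n + 1) n (-δ - ((s : ℤ) + 1) * n) := by
  have : ((s : ℤ) + 1) * n ≤ k * n := by gcongr; omega
  have : 0 ≤ (s : ℤ) * n := by positivity
  exact ⟨-1, by push_cast; linarith, by push_cast; linarith⟩

lemma mod_ne_mod_of_lt {k u v : ℕ} (h : u < v) (h' : v < u + k) : u % k ≠ v % k := by
  intro he
  have := Nat.le_of_dvd (by omega) ((Nat.modEq_iff_dvd' h.le).1 he)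
  omega

lemma exists_isCircTotalColoring_Gkn_of_three_le {k n : ℕ} (hk : 3 ≤ k) (hn : 1 ≤ n) :
    ∃ cv ce, IsCircTotalColoring (Gkn k n) ((k + 1) * n + 1) n cv ce := by
  have hlt : ∀ u, u % k < k := fun u => Nat.mod_lt _ (by omega)
  have hsymb : ∀ {u v : ℕ}, u ≠ v → u < v + k → v < u + k →
      FarMod ((k + 1) * n + 1) n ((((u % k : ℕ) : ℤ) + 1) * n - (((v % k : ℕ) : ℤ) + 1) * n) := by
    intro u v hne h1 h2
    rcases lt_or_gt_of_ne hne with h | h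
    · exact farMod_symbol (hlt _) (hlt _) (mod_ne_mod_of_lt h h2)
    · exact farMod_symbol (hlt _) (hlt _) (mod_ne_mod_of_lt h h1).symm
  have h0 : ∀ x : Fin k, (x : ℕ) = 0 → (k + 1 - x) % k = 1 := by
    intro x hx
    rw [hx, Nat.sub_zero, Nat.add_mod_left, Nat.mod_eq_of_lt (by omega)]
  have h1 : ∀ x : Fin k, (x : ℕ) = 1 → (k + 1 - x) % k = 0 := by
    intro x hx
    rw [hx, Nat.add_sub_cancel, Nat.mod_self]
  have hn' : (1 : ℤ) ≤ n := by exact_mod_cast hn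
  have hkn : 3 * (n : ℤ) ≤ k * n := by gcongr; exact_mod_cast hk
  refine exists_isCircTotalColoring_Gkn_of_block hn (by omega) hn
    (fun x => (((k + 1 - x) % k : ℕ) + 1) * n) (fun _ => 0)
    (fun x y => (((k + 2 + y - x) % k : ℕ) + 1) * n) 1 0 (2 * n + 1)
    ?_ ?_ ?_ ?_ ?_ ?_ ?_ ?_ ?_ ?_ ?_ ?_ ?_
  · intro x y
    simpa using (farMod_neg_symbol (n := n) (hlt (k + 1 - x)) le_rfl zero_le_one).neg
  · intro x y y' hne
    have := Fin.val_ne_of_ne hne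
    exact hsymb (by omega) (by omega) (by omega)
  · intro y x x' hne
    have := Fin.val_ne_of_ne hne
    exact hsymb (by omega) (by omega) (by omega)
  · intro x y
    exact hsymb (by omega) (by omega) (by omega)
  · intro x y
    simpa using (farMod_neg_symbol (n := n) (hlt (k + 2 + y - x)) le_rfl zero_le_one).neg
  · intro x y hx
    convert farMod_neg_symbol (n := n) (hlt (k + 2 + y - x)) (δ := 1 - (x : ℕ))
      (by omega) (by omega) using 1
    ring
  · intro x hx
    convert farMod_neg_symbol (n := n) (hlt (k + 1 - x)) (δ := 1 - (x : ℕ))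
      (by omega) (by omega) using 1
    ring
  · intro x x' hx hx'
    rw [h0 x hx, h1 x' hx']
    exact ⟨0, by push_cast; linarith, by push_cast; linarith⟩
  · intro x hx
    rw [h1 x hx]
    exact ⟨0, by push_cast; linarith, by push_cast; linarith⟩
  · intro x hx
    rw [h0 x hx]
    exact ⟨0, by push_cast; linarith, by push_cast; linarith⟩
  · exact ⟨-1, by push_cast; linarith, by push_cast; linarith⟩
  · exact ⟨-1, by push_cast; linarith, by push_cast; linarith⟩
  · exact ⟨0, by push_cast; linarith, by push_cast; linarith⟩

lemma exists_isCircTotalColoring_Gkn {k n : ℕ} (hk : 2 ≤ k) (hn : 1 ≤ n) :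
    ∃ cv ce, IsCircTotalColoring (Gkn k n) ((k + 1) * n + 1) n cv ce := by
  obtain rfl | hk := hk.eq_or_lt
  · exact exists_isCircTotalColoring_Gkn_two hn
  · exact exists_isCircTotalColoring_Gkn_of_three_le hk hn

lemma lt_circTotalChromatic_Gkn {k n : ℕ} (hk : 2 ≤ k) (hn : 1 ≤ n) :
    (k : ℝ) + 1 < circTotalChromatic (Gkn k n) := by
  have := lt_circTotalChromatic (by omega) (not_exists_isTotalColoring_Gkn hk hn)
    ⟨_, n, hn, exists_isCircTotalColoring_Gkn hk hn⟩
  exact_mod_cast this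

lemma circTotalChromatic_Gkn_le {k n : ℕ} (hk : 2 ≤ k) (hn : 1 ≤ n) :
    circTotalChromatic (Gkn k n) ≤ (k : ℝ) + 1 + 1 / n := by
  obtain ⟨cv, ce, h⟩ := exists_isCircTotalColoring_Gkn hk hn
  refine (circTotalChromatic_le hn h).trans_eq ?_
  have : (n : ℝ) ≠ 0 := by positivity
  push_cast
  field_simp

/-! ### The maximum degree of `Gkn` -/

lemma ncard_neighborSet_Gkn_inr {k n : ℕ} (i : Fin n) (y : Fin (k - 1)) :
    ((Gkn k n).neighborSet (some (i, Sum.inr y))).ncard = k := by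
  have : (Gkn k n).neighborSet (some (i, Sum.inr y)) =
      Set.range fun x : Fin k => some (i, Sum.inl x) := by
    ext w
    constructor
    · intro h
      obtain ⟨x, rfl⟩ := Gkn_adj_inr h
      exact ⟨x, rfl⟩
    · rintro ⟨x, rfl⟩
      exact (Gkn_adj_inl_inr i x y).symm
  rw [this, ← Set.image_univ, Set.ncard_image_of_injective _ (fun x x' h => by simpa using h),
    Set.ncard_univ, Nat.card_fin]

lemma ncard_neighborSet_Gkn_le {k n : ℕ} (hk : 2 ≤ k) (v) :
    ((Gkn k n).neighborSet v).ncard ≤ k := by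
  rcases v with _ | ⟨i, x | y⟩
  · have hsub : (Gkn k n).neighborSet none ⊆
        (fun b : Bool => if h : 0 < n then if b then some (⟨0, h⟩, Sum.inl ⟨1, by omega⟩) else
          some (⟨n - 1, by omega⟩, Sum.inl ⟨0, by omega⟩) else none) '' Set.univ := by
      intro w hw
      rcases Gkn_adj_none hw with ⟨⟨i, hi⟩, ⟨x, hx⟩, h1, h2, rfl⟩ | ⟨⟨i, hi⟩, ⟨x, hx⟩, h1, h2, rfl⟩
      · exact ⟨true, trivial, by dsimp only at h1 h2; subst h1 h2; simp [hi]⟩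
      · exact ⟨false, trivial, by dsimp only at h1 h2; subst h1 h2; simp [show 0 < n by omega]⟩
    refine (Set.ncard_le_ncard hsub).trans ((Set.ncard_image_le Set.finite_univ).trans ?_)
    simpa [Set.ncard_univ] using hk
  · set A := Set.range fun y : Fin (k - 1) =>
      (some (i, Sum.inr y) : Option (Fin n × (Fin k ⊕ Fin (k - 1))))
    have hA : A.ncard = k - 1 := by
      change (Set.range _).ncard = k - 1
      rw [← Set.image_univ, Set.ncard_image_of_injective _ (fun x x' h => by simpa using h),
        Set.ncard_univ, Nat.card_fin]
    have hdiff : ((Gkn k n).neighborSet (some (i, Sum.inl x)) \ A).ncard ≤ 1 := by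
      refine (Set.ncard_le_one (Set.toFinite _)).2 fun v hv w hw => ?_
      exact Gkn_adj_inl_unique hv.1 hw.1 (fun ⟨y, hy⟩ => hv.2 ⟨y, hy.symm⟩)
        (fun ⟨y, hy⟩ => hw.2 ⟨y, hy.symm⟩)
    have := Set.ncard_le_ncard_sdiff_add_ncard ((Gkn k n).neighborSet (some (i, Sum.inl x))) A
      (Set.toFinite _)
    omega
  · exact (ncard_neighborSet_Gkn_inr i y).le

lemma ncard_neighborSet_map_iso {V W : Type*} {G : SimpleGraph V} {H : SimpleGraph W}
    (φ : G ≃g H) (v : V) : (H.neighborSet (φ v)).ncard = (G.neighborSet v).ncard :=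
  (Nat.card_congr (φ.mapNeighborSet v)).symm

/-- `Gkn k n` transported to `Fin m`. -/
lemma exists_fin_circTotalChromatic_eq {k n : ℕ} (hk : 2 ≤ k) (hn : 1 ≤ n) :
    ∃ (m : ℕ) (G : SimpleGraph (Fin m)), (∀ v, (G.neighborSet v).ncard ≤ k) ∧
      (∃ v, (G.neighborSet v).ncard = k) ∧
      circTotalChromatic (Gkn k n) = circTotalChromatic G := by
  let φ := (Gkn k n).overFinIso rfl
  refine ⟨_, _, fun v => ?_, ⟨φ (some (⟨0, hn⟩, Sum.inr ⟨0, by omega⟩)), ?_⟩,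
    circTotalChromatic_congr φ⟩
  · obtain ⟨w, rfl⟩ := φ.surjective v
    rw [ncard_neighborSet_map_iso]
    exact ncard_neighborSet_Gkn_le hk w
  · rw [ncard_neighborSet_map_iso, ncard_neighborSet_Gkn_inr]

open Filter Topology in
theorem stmt11 (k : ℕ) (hk : 2 ≤ k) :
    (∀ n : ℕ, 1 ≤ n →
      (k : ℝ) + 1 < circTotalChromatic (Gkn k n) ∧
      circTotalChromatic (Gkn k n) ≤ (k : ℝ) + 1 + 1 / n) ∧
    Tendsto (fun n : ℕ => circTotalChromatic (Gkn k n)) atTop (𝓝 ((k : ℝ) + 1)) ∧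
    ((k : ℝ) + 1) ∈ closure
      ({x : ℝ | ∃ (m : ℕ) (G : SimpleGraph (Fin m)),
          (∀ v, (G.neighborSet v).ncard ≤ k) ∧ (∃ v, (G.neighborSet v).ncard = k) ∧
          x = circTotalChromatic G} \ {(k : ℝ) + 1}) := by
  have hlim : Tendsto (fun n : ℕ => circTotalChromatic (Gkn k n)) atTop (𝓝 ((k : ℝ) + 1)) := by
    refine tendsto_of_tendsto_of_tendsto_of_le_of_le' tendsto_const_nhds
      (h := fun n : ℕ => (k : ℝ) + 1 + 1 / n) ?_ ?_ ?_
    · simpa using tendsto_const_nhds.add (tendsto_one_div_atTop_nhds_zero_nat (𝕜 := ℝ))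
    · filter_upwards [eventually_ge_atTop 1] with n hn
      exact (lt_circTotalChromatic_Gkn hk hn).le
    · filter_upwards [eventually_ge_atTop 1] with n hn
      exact circTotalChromatic_Gkn_le hk hn
  refine ⟨fun n hn => ⟨lt_circTotalChromatic_Gkn hk hn, circTotalChromatic_Gkn_le hk hn⟩, hlim,
    mem_closure_of_tendsto hlim ?_⟩
  filter_upwards [eventually_ge_atTop 1] with n hn
  exact ⟨exists_fin_circTotalChromatic_eq hk hn, (lt_circTotalChromatic_Gkn hk hn).ne'⟩
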